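/- Let S be a simple system over R = F[x₁,…,x_n] and 1 ≤ k ≤ n such that S_{x_k} consists of one equation p=0. Then for every b ∈ Sol(S_{<x_k}) ⊆ F̄^{k−1}, the set of extensions {a ∈ F̄ : (b,a) ∈ Sol(S_{≤x_k})} has exactly mdeg(p) elements. -/

import Mathlib

open MvPolynomial

/-- An algebraic system over `F[x₁,…,xₙ]`: a finite set of equations `p = 0`
and a finite set of inequations `p ≠ 0`. -/
structure AlgSystem (F : Type*) [Field F] (n : ℕ) where
  eqs : Finset (MvPolynomial (Fin n) F)
  ineqs : Finset (MvPolynomial (Fin n) F)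

variable {F : Type*} [Field F] [CharZero F] {n : ℕ}

/-- `k` is the leader of `p`: the largest variable occurring in `p`. -/
def IsLeader (p : MvPolynomial (Fin n) F) (k : Fin n) : Prop :=
  k ∈ p.vars ∧ ∀ j ∈ p.vars, j ≤ k

/-- membership of a polynomial in a system (as an equation or an inequation). -/
def AlgSystem.Mem (S : AlgSystem F n) (p : MvPolynomial (Fin n) F) : Prop :=
  p ∈ S.eqs ∨ p ∈ S.ineqs

/-- `a ∈ Sol(S)`: `a` satisfies all equations and inequations of `S`. -/
def Sol (S : AlgSystem F n) (a : Fin n → AlgebraicClosure F) : Prop :=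
  (∀ p ∈ S.eqs, aeval a p = 0) ∧ (∀ p ∈ S.ineqs, aeval a p ≠ 0)

/-- `a` is a solution of the subsystem `S_{<x_k}` of all members of `S` whose
variables are all `< x_k` (only the coordinates `< k` of `a` matter). -/
def SolBelow (S : AlgSystem F n) (k : Fin n) (a : Fin n → AlgebraicClosure F) : Prop :=
  (∀ p ∈ S.eqs, (∀ j ∈ p.vars, j < k) → aeval a p = 0) ∧
  (∀ p ∈ S.ineqs, (∀ j ∈ p.vars, j < k) → aeval a p ≠ 0)

/-- `a` is a solution of the subsystem `S_{≤x_k}` of all members of `S` whose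
variables are all `≤ x_k` (only the coordinates `≤ k` of `a` matter). -/
def SolUpTo (S : AlgSystem F n) (k : Fin n) (a : Fin n → AlgebraicClosure F) : Prop :=
  (∀ p ∈ S.eqs, (∀ j ∈ p.vars, j ≤ k) → aeval a p = 0) ∧
  (∀ p ∈ S.ineqs, (∀ j ∈ p.vars, j ≤ k) → aeval a p ≠ 0)

/-- `φ_{<x_k,a}(p)`: the univariate polynomial over `F̄` obtained from `p` by
substituting `a i` for `x_i` (`i ≠ k`) and keeping `x_k` as the variable. -/
noncomputable def uni (a : Fin n → AlgebraicClosure F) (k : Fin n)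
    (p : MvPolynomial (Fin n) F) : Polynomial (AlgebraicClosure F) :=
  aeval (fun i => if i = k then (Polynomial.X : Polynomial (AlgebraicClosure F))
    else Polynomial.C (a i)) p

/-- The initial of `p` with respect to the variable `x_k`: the leading coefficient
of `p` regarded as a univariate polynomial in `x_k`. -/
noncomputable def initOf (p : MvPolynomial (Fin n) F) (k : Fin n) :
    MvPolynomial (Fin n) F :=
  ∑ m ∈ p.support.filter (fun m => m k = p.degreeOf k),
    monomial (m.erase k) (coeff m p)

/-- Triangularity: at most one member of `S` has leader `x_k`, for each `k`,
and `S` contains no constant polynomial. -/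
def Triangular (S : AlgSystem F n) : Prop :=
  (∀ k : Fin n, ∀ p, S.Mem p → ∀ q, S.Mem q → IsLeader p k → IsLeader q k → p = q) ∧
  (∀ k : Fin n, ∀ p, IsLeader p k → ¬(p ∈ S.eqs ∧ p ∈ S.ineqs)) ∧
  (∀ p, S.Mem p → p.vars.Nonempty)

/-- Non-vanishing initials: for every member `p` of `S` with leader `x_k` and every
solution `a` of `S_{<x_k}`, `init(p)` does not vanish at `a`. -/
def NonVanishingInitials (S : AlgSystem F n) : Prop :=
  ∀ k : Fin n, ∀ p, S.Mem p → IsLeader p k →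
    ∀ a : Fin n → AlgebraicClosure F, SolBelow S k a → aeval a (initOf p k) ≠ 0

/-- Square-freeness: for every member `p` of `S` with leader `x_k` and every
solution `a` of `S_{<x_k}`, the univariate polynomial `φ_{<x_k,a}(p)` is squarefree. -/
def SquarefreeCond (S : AlgSystem F n) : Prop :=
  ∀ k : Fin n, ∀ p, S.Mem p → IsLeader p k →
    ∀ a : Fin n → AlgebraicClosure F, SolBelow S k a → Squarefree (uni a k p)

/-- A simple system. -/
def Simple (S : AlgSystem F n) : Prop :=
  Triangular S ∧ NonVanishingInitials S ∧ SquarefreeCond S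

theorem uni_eq_sum (a : Fin n → AlgebraicClosure F) (k : Fin n)
    (p : MvPolynomial (Fin n) F) :
    uni a k p = ∑ m ∈ p.support, Polynomial.monomial (m k)
      (aeval a (monomial (m.erase k) (coeff m p))) := by
  unfold uni
  rw [aeval_def, eval₂_eq']
  refine Finset.sum_congr rfl fun m _ => ?_
  rw [aeval_monomial, Finsupp.prod_fintype _ _ (by simp),
    ← Finset.mul_prod_erase Finset.univ _ (Finset.mem_univ k),
    ← Finset.mul_prod_erase Finset.univ (fun i => a i ^ (m.erase k) i) (Finset.mem_univ k)]
  have h1 : ∏ i ∈ Finset.univ.erase k,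
      (if i = k then (Polynomial.X : Polynomial (AlgebraicClosure F))
        else Polynomial.C (a i)) ^ m i
      = Polynomial.C (∏ i ∈ Finset.univ.erase k, a i ^ (m.erase k) i) := by
    rw [map_prod]
    refine Finset.prod_congr rfl fun i hi => ?_
    have hik : i ≠ k := Finset.ne_of_mem_erase hi
    simp [hik]
  rw [h1, ← Polynomial.C_mul_X_pow_eq_monomial]
  simp only [if_true, Finsupp.erase_same, pow_zero, one_mul, Polynomial.C_mul,
    IsScalarTower.algebraMap_apply F (AlgebraicClosure F) (Polynomial (AlgebraicClosure F)),
    Polynomial.algebraMap_eq]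
  ring

theorem uni_natDegree (a : Fin n → AlgebraicClosure F) (k : Fin n)
    (p : MvPolynomial (Fin n) F) (h : aeval a (initOf p k) ≠ 0) :
    (uni a k p).natDegree = p.degreeOf k := by
  apply le_antisymm
  · rw [uni_eq_sum]
    refine Polynomial.natDegree_sum_le_of_forall_le _ _ fun m hm => ?_
    exact (Polynomial.natDegree_monomial_le _).trans (monomial_le_degreeOf k hm)
  · apply Polynomial.le_natDegree_of_ne_zero
    rw [uni_eq_sum, Polynomial.finset_sum_coeff]
    simp only [Polynomial.coeff_monomial]
    rw [← Finset.sum_filter, ← map_sum]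
    exact h

theorem eval_uni (a : Fin n → AlgebraicClosure F) (k : Fin n)
    (p : MvPolynomial (Fin n) F) (c : AlgebraicClosure F) :
    (uni a k p).eval c = aeval (Function.update a k c) p := by
  unfold uni
  rw [aeval_def, aeval_def, eval₂_eq', eval₂_eq', Polynomial.eval_finset_sum]
  refine Finset.sum_congr rfl fun m _ => ?_
  rw [Polynomial.eval_mul, Polynomial.eval_prod,
    IsScalarTower.algebraMap_apply F (AlgebraicClosure F) (Polynomial (AlgebraicClosure F)),
    Polynomial.algebraMap_eq, Polynomial.eval_C]
  congr 1
  refine Finset.prod_congr rfl fun i _ => ?_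
  by_cases hik : i = k
  · subst hik; simp
  · simp [hik]

theorem aeval_update_of_notMem (a : Fin n → AlgebraicClosure F) (k : Fin n)
    (q : MvPolynomial (Fin n) F) (c : AlgebraicClosure F) (hk : k ∉ q.vars) :
    aeval (Function.update a k c) q = aeval a q := by
  refine eval₂Hom_congr' rfl ?_ rfl
  intro i hi _
  have hik : i ≠ k := fun h => hk (h ▸ hi)
  exact Function.update_of_ne hik _ _

/-- If `S` is simple and `S_{x_k}` consists of one equation `p = 0`, then every
solution `b` of `S_{<x_k}` has exactly `mdeg(p)` extensions to a solution of
`S_{≤x_k}`. -/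
theorem simple_equation_fiber_card (S : AlgSystem F n) (hS : Simple S) (k : Fin n)
    (p : MvPolynomial (Fin n) F) (hp : p ∈ S.eqs) (hld : IsLeader p k)
    (a : Fin n → AlgebraicClosure F) (ha : SolBelow S k a) :
    ∃ A : Finset (AlgebraicClosure F), A.card = p.degreeOf k ∧
      ∀ c : AlgebraicClosure F, SolUpTo S k (Function.update a k c) ↔ c ∈ A := by
  obtain ⟨⟨ht, hd, -⟩, hi, hs⟩ := hS
  have hsq := hs k p (Or.inl hp) hld a ha
  have hdeg := uni_natDegree a k p (hi k p (Or.inl hp) hld a ha)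
  have hnd : (uni a k p).roots.Nodup :=
    Polynomial.nodup_roots (PerfectField.separable_iff_squarefree.mpr hsq)
  refine ⟨⟨(uni a k p).roots, hnd⟩, ?_, fun c => ?_⟩
  · rw [Finset.card_mk, IsAlgClosed.card_roots_eq_natDegree, hdeg]
  · rw [Finset.mem_mk, Polynomial.mem_roots hsq.ne_zero, Polynomial.IsRoot, eval_uni]
    constructor
    · intro h
      exact h.1 p hp hld.2
    · intro h
      refine ⟨fun q hq hv => ?_, fun q hq hv => ?_⟩
      · by_cases hk : k ∈ q.vars
        · rw [← ht k p (Or.inl hp) q (Or.inl hq) hld ⟨hk, hv⟩]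
          exact h
        · rw [aeval_update_of_notMem a k q c hk]
          exact ha.1 q hq fun j hj => lt_of_le_of_ne (hv j hj) fun e => hk (e ▸ hj)
      · by_cases hk : k ∈ q.vars
        · have e := ht k p (Or.inl hp) q (Or.inr hq) hld ⟨hk, hv⟩
          exact absurd ⟨hp, e ▸ hq⟩ (hd k p hld)
        · rw [aeval_update_of_notMem a k q c hk]
          exact ha.2 q hq fun j hj => lt_of_le_of_ne (hv j hj) fun e => hk (e ▸ hj)
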